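/- arXiv:1902.09397 — 6 statements merged into one kernel-verified Lean document; each statement's English description precedes it below -/
import Mathlib

section
/- Let 0 < r < a, γ(t) = a + r·cos t, and let L be the operator (L f)(t) = −(1/r²)·f''(t) + (sin t/(r·γ(t)))·f'(t) acting on smooth functions f : ℝ → ℝ. Then for n₃(t) = −sin t there exist a nonzero real number c and a real polynomial F in two variables of total degree at most 3 such that for all t ∈ ℝ: (L² n₃)(t) = c·sin³t·cos t/(r·γ(t)³) + F(sin t, cos t)/γ(t)². -/
/-- The Laplace–Beltrami operator of the anchor ring's first fundamental form
`I = r² dt² + γ(t)² dφ²` (with `γ(t) = a + r cos t`), restricted to functions of `t`: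
`(L f)(t) = −(1/r²)·f''(t) + (sin t/(r·γ(t)))·f'(t)`. -/
noncomputable def Lop (a r : ℝ) (f : ℝ → ℝ) (t : ℝ) : ℝ :=
  -(1 / r ^ 2) * deriv (deriv f) t
    + (Real.sin t / (r * (a + r * Real.cos t))) * deriv f t

open MvPolynomial in
/-- The value of a real bivariate polynomial of the shape occurring as the numerator of `L² n₃`
has total degree at most three. -/
theorem totalDegree_anchorRing_numerator_le (a r p q m n : ℝ) :
    (X 0 * (C p * (C a + C r * X 1) ^ 2 + C q * (C a + C r * X 1) + C m * X 1 + C n * X 0 ^ 2) :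
      MvPolynomial (Fin 2) ℝ).totalDegree ≤ 3 := by
  have hC (k : ℝ) (P : MvPolynomial (Fin 2) ℝ) {d : ℕ} (h : P.totalDegree ≤ d) :
      (C k * P).totalDegree ≤ d := by
    simpa using (totalDegree_mul (C k) P).trans (add_le_add (totalDegree_C k).le h)
  have hadd {P Q : MvPolynomial (Fin 2) ℝ} {d : ℕ} (hP : P.totalDegree ≤ d)
      (hQ : Q.totalDegree ≤ d) : (P + Q).totalDegree ≤ d :=
    (totalDegree_add P Q).trans (max_le hP hQ)
  have hX (i : Fin 2) : (X i : MvPolynomial (Fin 2) ℝ).totalDegree ≤ 1 := (totalDegree_X i).le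
  have hG : (C a + C r * X 1 : MvPolynomial (Fin 2) ℝ).totalDegree ≤ 1 :=
    hadd (by simp) (hC r _ (hX 1))
  have hsq {P : MvPolynomial (Fin 2) ℝ} (hP : P.totalDegree ≤ 1) : (P ^ 2).totalDegree ≤ 2 :=
    (totalDegree_pow P 2).trans (by lia)
  refine (totalDegree_mul _ _).trans (add_le_add (hX 0) (?_ : _ ≤ 2))
  exact hadd (hadd (hadd (hC p _ (hsq hG)) (hC q _ (hG.trans one_le_two)))
    (hC m _ ((hX 1).trans one_le_two))) (hC n _ (hsq (hX 0)))

theorem Lop_eq_of_hasDerivAt {a r t f'' : ℝ} {f f' : ℝ → ℝ} (hf : ∀ s, HasDerivAt f (f' s) s)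
    (hf' : HasDerivAt f' f'' t) :
    Lop a r f t
      = -(1 / r ^ 2) * f'' + (Real.sin t / (r * (a + r * Real.cos t))) * f' t := by
  have h : deriv f = f' := funext fun s => (hf s).deriv
  rw [Lop, h, hf'.deriv]

theorem Lop_neg_sin {a r : ℝ} (hr : r ≠ 0) (hγ : ∀ t, a + r * Real.cos t ≠ 0) :
    Lop a r (fun s => -Real.sin s)
      = fun t => -2 / r ^ 2 * Real.sin t + a / r ^ 2 * (Real.sin t / (a + r * Real.cos t)) := by
  funext t
  refine (Lop_eq_of_hasDerivAt (fun s => (Real.hasDerivAt_sin s).neg)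
    (Real.hasDerivAt_cos t).neg).trans ?_
  have := hγ t
  field_simp
  ring

/-- The action of `L` on combinations of `sin` and `sin / γ`. -/
theorem Lop_sin_add_sin_div {a r : ℝ} (hr : r ≠ 0) (hγ : ∀ t, a + r * Real.cos t ≠ 0)
    (k l t : ℝ) :
    Lop a r (fun t => k * Real.sin t + l * (Real.sin t / (a + r * Real.cos t))) t
      = k * (2 * Real.sin t / r ^ 2 - a * Real.sin t / (r ^ 2 * (a + r * Real.cos t)))
        + l * (Real.sin t / (r ^ 2 * (a + r * Real.cos t))
          - 2 * Real.sin t * Real.cos t / (r * (a + r * Real.cos t) ^ 2)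
          - Real.sin t ^ 3 / (a + r * Real.cos t) ^ 3) := by
  have hγ' (s : ℝ) : HasDerivAt (fun t => a + r * Real.cos t) (r * -Real.sin s) s :=
    ((Real.hasDerivAt_cos s).const_mul r).const_add a
  have h1 (s : ℝ) := ((Real.hasDerivAt_sin s).const_mul k).add
    (((Real.hasDerivAt_sin s).div (hγ' s) (hγ s)).const_mul l)
  have h2 := ((Real.hasDerivAt_cos t).const_mul k).add
    (((((Real.hasDerivAt_cos t).mul (hγ' t)).sub
      ((Real.hasDerivAt_sin t).mul ((Real.hasDerivAt_sin t).neg.const_mul r))).div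
        ((hγ' t).pow 2) (pow_ne_zero 2 (hγ t))).const_mul l)
  refine (Lop_eq_of_hasDerivAt h1 h2).trans ?_
  have := hγ t
  simp only [Pi.mul_apply, Pi.sub_apply, Pi.pow_apply, Pi.neg_apply]
  field_simp
  ring

/-- For the third Gauss map component `n₃(t) = −sin t` of the anchor ring, there exist a
nonzero constant `c` and a real polynomial `F` in two variables of total degree at most 3
such that `(L² n₃)(t) = c·sin³t·cos t/(r·γ(t)³) + F(sin t, cos t)/γ(t)²`. -/
theorem anchorRing_L2_n3_structure (a r : ℝ) (hr : 0 < r) (hra : r < a) :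
    ∃ c : ℝ, c ≠ 0 ∧ ∃ F : MvPolynomial (Fin 2) ℝ, F.totalDegree ≤ 3 ∧
      ∀ t : ℝ,
        (Lop a r)^[2] (fun s => -Real.sin s) t
          = c * Real.sin t ^ 3 * Real.cos t / (r * (a + r * Real.cos t) ^ 3)
            + MvPolynomial.eval ![Real.sin t, Real.cos t] F
                / (a + r * Real.cos t) ^ 2 := by
  have hr' : r ≠ 0 := hr.ne'
  have hγ (t : ℝ) : a + r * Real.cos t ≠ 0 := by
    nlinarith [Real.neg_one_le_cos t]
  refine ⟨1, one_ne_zero, _, totalDegree_anchorRing_numerator_le a r (-4 / r ^ 4) (3 * a / r ^ 4)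
    (-2 * a / r ^ 3) (-1 / r ^ 2), fun t => ?_⟩
  rw [Function.iterate_succ_apply, Function.iterate_one, Lop_neg_sin hr' hγ,
    Lop_sin_add_sin_div hr' hγ]
  simp only [map_add, map_mul, map_pow, MvPolynomial.eval_X, MvPolynomial.eval_C,
    Matrix.cons_val_zero, Matrix.cons_val_one]
  have := hγ t
  field_simp
  ring
end

section
/- Let 0 < r < a, γ(t) = a + r·cos t, and let L be the operator (L f)(t) = −(1/r²)·f''(t) + (sin t/(r·γ(t)))·f'(t) acting on smooth functions f : ℝ → ℝ. Then for n₃(t) = −sin t there exist a nonzero real number c and a real polynomial F in two variables of total degree at most 5 such that for all t ∈ ℝ: (L³ n₃)(t) = c·sin⁵t·cos t/(r·γ(t)⁵) + F(sin t, cos t)/γ(t)⁴. -/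
/-- The radius `a + r cos t` of the parallel circle is positive when `0 < r < a`. -/
theorem anchorRing_radius_pos {a r : ℝ} (hr : 0 < r) (hra : r < a) (t : ℝ) :
    0 < a + r * Real.cos t := by
  nlinarith [Real.neg_one_le_cos t]

/-- Product rule for `sin t · h(a + r cos t)`. -/
theorem hasDerivAt_sin_mul_comp {a r : ℝ} {h : ℝ → ℝ} {h' t : ℝ}
    (hh : HasDerivAt h h' (a + r * Real.cos t)) :
    HasDerivAt (fun s => Real.sin s * h (a + r * Real.cos s))
      (Real.cos t * h (a + r * Real.cos t) - r * Real.sin t ^ 2 * h') t := by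
  have hg : HasDerivAt (fun s => a + r * Real.cos s) (r * -Real.sin t) t :=
    ((Real.hasDerivAt_cos t).const_mul r).const_add a
  refine ((Real.hasDerivAt_sin t).mul (HasDerivAt.comp t hh hg)).congr_deriv ?_
  simp only [Function.comp]
  ring

/-- `Lop` on functions of the form `sin t · h(a + r cos t)`. -/
theorem Lop_sin_mul_comp {a r : ℝ} (hr : 0 < r) (hra : r < a) {h h' h'' : ℝ → ℝ}
    (hh : ∀ x, 0 < x → HasDerivAt h (h' x) x)
    (hh' : ∀ x, 0 < x → HasDerivAt h' (h'' x) x) (t : ℝ) :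
    Lop a r (fun s => Real.sin s * h (a + r * Real.cos s)) t =
      Real.sin t * (h (a + r * Real.cos t) / r ^ 2
        + 3 * Real.cos t * h' (a + r * Real.cos t) / r
        - Real.sin t ^ 2 * h'' (a + r * Real.cos t)
        + (Real.cos t * h (a + r * Real.cos t) - r * Real.sin t ^ 2 * h' (a + r * Real.cos t))
          / (r * (a + r * Real.cos t))) := by
  have hpos := anchorRing_radius_pos hr hra
  have hderiv : deriv (fun s => Real.sin s * h (a + r * Real.cos s)) = fun s =>
      Real.cos s * h (a + r * Real.cos s)
        - r * (Real.sin s * (Real.sin s * h' (a + r * Real.cos s))) := by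
    funext s
    rw [(hasDerivAt_sin_mul_comp (hh _ (hpos s))).deriv]
    ring
  have hg : HasDerivAt (fun s => a + r * Real.cos s) (r * -Real.sin t) t :=
    ((Real.hasDerivAt_cos t).const_mul r).const_add a
  have hderiv₂ := (((Real.hasDerivAt_cos t).mul (HasDerivAt.comp t (hh _ (hpos t)) hg)).sub
    (((Real.hasDerivAt_sin t).mul (hasDerivAt_sin_mul_comp (hh' _ (hpos t)))).const_mul r)).deriv
  have hderiv₂' : deriv (fun s => Real.cos s * h (a + r * Real.cos s)
        - r * (Real.sin s * (Real.sin s * h' (a + r * Real.cos s)))) t = _ := hderiv₂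
  rw [Lop, hderiv, hderiv₂']
  have hne := (hpos t).ne'
  simp only [Function.comp]
  field_simp
  ring

/-- `Lop` on the span of `sin t · γ⁻ᵏ`, `k = 0, 1, 3`, where `γ = a + r cos t`. -/
theorem Lop_sin_mul_inv_powers {a r : ℝ} (hr : 0 < r) (hra : r < a) (α β δ t : ℝ) :
    Lop a r (fun s => Real.sin s * (α + β / (a + r * Real.cos s)
        + δ / (a + r * Real.cos s) ^ 3)) t =
      Real.sin t * (2 * α - a * α / (a + r * Real.cos t)
        + ((a ^ 2 - r ^ 2) * β + 2 * δ) / (a + r * Real.cos t) ^ 3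
        - 10 * a * δ / (a + r * Real.cos t) ^ 4
        + 9 * (a ^ 2 - r ^ 2) * δ / (a + r * Real.cos t) ^ 5) / r ^ 2 := by
  have hpow (n : ℕ) (c x : ℝ) (hx : 0 < x) :
      HasDerivAt (fun y : ℝ => c / y ^ (n + 1)) (-(n + 1) * c / x ^ (n + 2)) x := by
    refine ((hasDerivAt_const x c).div (hasDerivAt_pow (n + 1) x)
      (pow_ne_zero _ hx.ne')).congr_deriv ?_
    push_cast
    field_simp
    ring
  rw [Lop_sin_mul_comp hr hra (h := fun x => α + β / x + δ / x ^ 3)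
    (h' := fun x => -β / x ^ 2 - 3 * δ / x ^ 4)
    (h'' := fun x => 2 * β / x ^ 3 + 12 * δ / x ^ 5)]
  · have hne := (anchorRing_radius_pos hr hra t).ne'
    have hcos : Real.cos t = (a + r * Real.cos t - a) / r := by field_simp; ring
    rw [Real.sin_sq]
    generalize hg : a + r * Real.cos t = g at *
    rw [hcos]
    field_simp
    ring
  · intro x hx
    have hd := ((hpow 0 β x hx).const_add α).add (hpow 2 δ x hx)
    norm_num at hd
    exact hd.congr_deriv (by ring)
  · intro x hx
    have hd := (hpow 1 (-β) x hx).sub (hpow 3 (3 * δ) x hx)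
    norm_num at hd
    exact hd.congr_deriv (by ring)

open MvPolynomial in
/-- A quartic in `a + r Y`, multiplied by `X`, has total degree at most `5`. -/
theorem totalDegree_X_mul_sum_affine_pow_le (a r : ℝ) (k : Fin 5 → ℝ) :
    (X 0 * ∑ i : Fin 5, C (k i) * (C a + C r * X 1) ^ (i : ℕ) :
      MvPolynomial (Fin 2) ℝ).totalDegree ≤ 5 := by
  have hlin : (C a + C r * X 1 : MvPolynomial (Fin 2) ℝ).totalDegree ≤ 1 := by
    refine (totalDegree_add _ _).trans (max_le (by simp) ?_)
    exact (totalDegree_mul _ _).trans (by simp)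
  refine (totalDegree_mul _ _).trans ?_
  rw [totalDegree_X]
  have hsum := totalDegree_finsetSum_le (s := Finset.univ) (d := 4)
    (f := fun i : Fin 5 => C (k i) * (C a + C r * X 1 : MvPolynomial (Fin 2) ℝ) ^ (i : ℕ))
    fun i _ => by
      refine (totalDegree_mul _ _).trans ?_
      rw [totalDegree_C, zero_add]
      refine (totalDegree_pow _ _).trans ?_
      have := Nat.mul_le_mul_left (i : ℕ) hlin
      omega
  omega

/-- For the third Gauss map component `n₃(t) = −sin t` of the anchor ring, there exist a
nonzero constant `c` and a real polynomial `F` in two variables of total degree at most 5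
such that `(L³ n₃)(t) = c·sin⁵t·cos t/(r·γ(t)⁵) + F(sin t, cos t)/γ(t)⁴`. -/
theorem anchorRing_L3_n3_structure (a r : ℝ) (hr : 0 < r) (hra : r < a) :
    ∃ c : ℝ, c ≠ 0 ∧ ∃ F : MvPolynomial (Fin 2) ℝ, F.totalDegree ≤ 5 ∧
      ∀ t : ℝ,
        (Lop a r)^[3] (fun s => -Real.sin s) t
          = c * Real.sin t ^ 5 * Real.cos t / (r * (a + r * Real.cos t) ^ 5)
            + MvPolynomial.eval ![Real.sin t, Real.cos t] F
                / (a + r * Real.cos t) ^ 4 := by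
  let k : Fin 5 → ℝ := fun i =>
    ![9 * (a ^ 2 - r ^ 2) ^ 2 + 26 * a ^ 2 * (a ^ 2 - r ^ 2),
      -(50 * a * (a ^ 2 - r ^ 2) + 36 * a ^ 3),
      18 * (a ^ 2 - r ^ 2) + 72 * a ^ 2, -(41 * a), 1] i / r ^ 6
  refine ⟨-9, by norm_num, _, totalDegree_X_mul_sum_affine_pow_le a r k, fun t => ?_⟩
  have hpos := anchorRing_radius_pos hr hra
  have h₁ : Lop a r (fun s => -Real.sin s) = fun s => Real.sin s * (-2 / r ^ 2
      + a / r ^ 2 / (a + r * Real.cos s) + 0 / (a + r * Real.cos s) ^ 3) := by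
    funext s
    have h := Lop_sin_mul_inv_powers hr hra (-1) 0 0 s
    simp only [zero_div, add_zero, mul_neg_one] at h
    rw [h]
    have := (hpos s).ne'
    field_simp
    ring
  have h₂ : Lop a r (Lop a r (fun s => -Real.sin s)) = fun s => Real.sin s * (-4 / r ^ 4
      + 2 * a / r ^ 4 / (a + r * Real.cos s)
      + a * (a ^ 2 - r ^ 2) / r ^ 4 / (a + r * Real.cos s) ^ 3) := by
    rw [h₁]
    funext s
    rw [Lop_sin_mul_inv_powers hr hra]
    have := (hpos s).ne'
    field_simp
    ring
  change Lop a r (Lop a r (Lop a r (fun s => -Real.sin s))) t = _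
  rw [h₂, Lop_sin_mul_inv_powers hr hra]
  simp only [map_mul, map_add, map_pow, MvPolynomial.eval_X, MvPolynomial.eval_C,
    Fin.sum_univ_five, k]
  have hne := (hpos t).ne'
  have hcos : Real.cos t = (a + r * Real.cos t - a) / r := by field_simp; ring
  have hsin : Real.sin t ^ 5 = Real.sin t * (1 - Real.cos t ^ 2) ^ 2 := by
    rw [← Real.sin_sq]; ring
  rw [hsin]
  simp
  generalize hg : a + r * Real.cos t = g at *
  rw [hcos]
  field_simp
  ring
end

section
/- Let 0 < r < a, γ(t) = a + r·cos t, and let L be the operator (L f)(t) = −(1/r²)·f''(t) + (sin t/(r·γ(t)))·f'(t) acting on smooth functions f : ℝ → ℝ. For every integer k ≥ 1 there exists a real polynomial Q in two variables of total degree at most 2k+1 such that, for all t ∈ ℝ, L( t ↦ sin^{2k−1}t·cos t / γ(t)^{2k−1} )(t) = −(2k−1)²·sin^{2k+1}t·cos t / γ(t)^{2k+1} + Q(sin t, cos t)/γ(t)^{2k}. -/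
open MvPolynomial in
theorem totalDegree_C_mul_X_pow_mul_X_pow_le {d i j : ℕ} (x : ℝ) (h : i + j ≤ d) :
    (C x * X 0 ^ i * X 1 ^ j : MvPolynomial (Fin 2) ℝ).totalDegree ≤ d := by
  refine (totalDegree_mul _ _).trans ?_
  have h1 : (C x * X 0 ^ i : MvPolynomial (Fin 2) ℝ).totalDegree ≤ i := by
    refine (totalDegree_mul _ _).trans ?_
    simp
  have h2 : (X 1 ^ j : MvPolynomial (Fin 2) ℝ).totalDegree ≤ j := by simp
  omega

theorem totalDegree_add_le_of_le {d : ℕ} {p q : MvPolynomial (Fin 2) ℝ}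
    (hp : p.totalDegree ≤ d) (hq : q.totalDegree ≤ d) : (p + q).totalDegree ≤ d :=
  (MvPolynomial.totalDegree_add p q).trans (max_le hp hq)

theorem hasDerivAt_sin_pow_mul_cos_pow_div (a r : ℝ) (i j l : ℕ) (t : ℝ)
    (h : a + r * Real.cos t ≠ 0) :
    HasDerivAt (fun s => Real.sin s ^ i * Real.cos s ^ j / (a + r * Real.cos s) ^ l)
      ((i * Real.sin t ^ (i - 1) * Real.cos t ^ (j + 1)
          - j * Real.sin t ^ (i + 1) * Real.cos t ^ (j - 1)) / (a + r * Real.cos t) ^ l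
        + l * r * Real.sin t ^ (i + 1) * Real.cos t ^ j / (a + r * Real.cos t) ^ (l + 1)) t := by
  have hg : HasDerivAt (fun s => a + r * Real.cos s) (r * -Real.sin t) t :=
    ((Real.hasDerivAt_cos t).const_mul r).const_add a
  have H := (((Real.hasDerivAt_sin t).fun_pow i).fun_mul
    ((Real.hasDerivAt_cos t).fun_pow j)).fun_div (hg.fun_pow l) (pow_ne_zero l h)
  refine H.congr_deriv ?_
  generalize a + r * Real.cos t = g at h
  rcases l with _ | l
  · simp
    ring
  · push_cast
    field_simp
    ring

open MvPolynomial in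
/-- The numerator of the lower-order part of `L(sin^{n+1} cos / γ^{n+1})` over `γ^{n+2}`. -/
noncomputable def remainderPoly (a r : ℝ) (n : ℕ) : MvPolynomial (Fin 2) ℝ :=
  C (-(a * (n + 1) * n / r ^ 2)) * X 0 ^ (n - 1) * X 1 ^ 3
    + C (-((n + 1) * n / r)) * X 0 ^ (n - 1) * X 1 ^ 4
    + C (a * (3 * n + 4) / r ^ 2) * X 0 ^ (n + 1) * X 1 ^ 1
    + C ((3 * n + 4) / r - (n + 1) * (2 * n + 2) / r) * X 0 ^ (n + 1) * X 1 ^ 2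
    + C ((2 * n + 1) / r) * X 0 ^ (n + 3) * X 1 ^ 0

theorem totalDegree_remainderPoly_le (a r : ℝ) (n : ℕ) :
    (remainderPoly a r n).totalDegree ≤ n + 3 := by
  unfold remainderPoly
  refine totalDegree_add_le_of_le (totalDegree_add_le_of_le (totalDegree_add_le_of_le
    (totalDegree_add_le_of_le ?_ ?_) ?_) ?_) ?_
  · exact totalDegree_C_mul_X_pow_mul_X_pow_le _ (by omega)
  · rcases n with _ | n
    · simp
    · exact totalDegree_C_mul_X_pow_mul_X_pow_le _ (by omega)
  all_goals exact totalDegree_C_mul_X_pow_mul_X_pow_le _ (by omega)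

theorem Lop_sin_pow_mul_cos_div (a r : ℝ) (hr : 0 < r) (hra : r < a) (n : ℕ) (t : ℝ) :
    Lop a r (fun s => Real.sin s ^ (n + 1) * Real.cos s / (a + r * Real.cos s) ^ (n + 1)) t
      = -((n : ℝ) + 1) ^ 2 * Real.sin t ^ (n + 3) * Real.cos t / (a + r * Real.cos t) ^ (n + 3)
        + MvPolynomial.eval ![Real.sin t, Real.cos t] (remainderPoly a r n)
          / (a + r * Real.cos t) ^ (n + 2) := by
  have hg : ∀ s, a + r * Real.cos s ≠ 0 := fun s => by
    nlinarith [Real.neg_one_le_cos s]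
  have hf' : deriv (fun s => Real.sin s ^ (n + 1) * Real.cos s / (a + r * Real.cos s) ^ (n + 1))
      = fun s => (n + 1) * (Real.sin s ^ n * Real.cos s ^ 2 / (a + r * Real.cos s) ^ (n + 1))
          - Real.sin s ^ (n + 2) * Real.cos s ^ 0 / (a + r * Real.cos s) ^ (n + 1)
          + (n + 1) * r * (Real.sin s ^ (n + 2) * Real.cos s ^ 1
              / (a + r * Real.cos s) ^ (n + 2)) := by
    funext s
    have H := hasDerivAt_sin_pow_mul_cos_pow_div a r (n + 1) 1 (n + 1) s (hg s)
    simp only [pow_one] at H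
    rw [H.deriv]
    push_cast
    ring
  have hf'' := ((((hasDerivAt_sin_pow_mul_cos_pow_div a r n 2 (n + 1) t (hg t)).const_mul
    ((n : ℝ) + 1)).fun_sub
    (hasDerivAt_sin_pow_mul_cos_pow_div a r (n + 2) 0 (n + 1) t (hg t))).fun_add
    ((hasDerivAt_sin_pow_mul_cos_pow_div a r (n + 2) 1 (n + 2) t (hg t)).const_mul
      (((n : ℝ) + 1) * r))).deriv
  unfold Lop
  rw [hf', hf'']
  simp only [remainderPoly, map_add, map_mul, map_pow, MvPolynomial.eval_C, MvPolynomial.eval_X,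
    Matrix.cons_val_zero, Matrix.cons_val_one]
  have hgt := hg t
  have hr0 := hr.ne'
  generalize Real.sin t ^ (n - 1) = u
  obtain ⟨g, hgdef⟩ : ∃ g, g = a + r * Real.cos t := ⟨_, rfl⟩
  obtain rfl : a = g - r * Real.cos t := by linarith
  simp only [sub_add_cancel] at hgt ⊢
  generalize Real.sin t = x
  generalize Real.cos t = y
  push_cast
  field_simp
  ring

/-- For every `k ≥ 1` there is a real polynomial `Q` in two variables of total degree at
most `2k+1` such that
`L(sin^{2k−1}t·cos t/γ(t)^{2k−1}) = −(2k−1)²·sin^{2k+1}t·cos t/γ(t)^{2k+1}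
  + Q(sin t, cos t)/γ(t)^{2k}`. -/
theorem anchorRing_L_step (a r : ℝ) (hr : 0 < r) (hra : r < a) (k : ℕ) (hk : 1 ≤ k) :
    ∃ Q : MvPolynomial (Fin 2) ℝ, Q.totalDegree ≤ 2 * k + 1 ∧
      ∀ t : ℝ,
        Lop a r
            (fun s => Real.sin s ^ (2 * k - 1) * Real.cos s
                / (a + r * Real.cos s) ^ (2 * k - 1)) t
          = -((2 * k : ℝ) - 1) ^ 2 * Real.sin t ^ (2 * k + 1) * Real.cos t
                / (a + r * Real.cos t) ^ (2 * k + 1)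
            + MvPolynomial.eval ![Real.sin t, Real.cos t] Q
                / (a + r * Real.cos t) ^ (2 * k) := by
  obtain ⟨n, rfl⟩ : ∃ n, k = n + 1 := ⟨k - 1, by omega⟩
  refine ⟨remainderPoly a r (2 * n), totalDegree_remainderPoly_le a r (2 * n), fun t => ?_⟩
  have h := Lop_sin_pow_mul_cos_div a r hr hra (2 * n) t
  rw [show 2 * (n + 1) - 1 = 2 * n + 1 by omega, show 2 * (n + 1) + 1 = 2 * n + 3 by ring,
    show 2 * (n + 1) = 2 * n + 2 by ring, h]
  push_cast
  ring
end

section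
/- Let 0 < r < a, γ(t) = a + r·cos t, and let L be the operator (L f)(t) = −(1/r²)·f''(t) + (sin t/(r·γ(t)))·f'(t) acting on smooth functions f : ℝ → ℝ. Then for every integer m ≥ 1 there exist a nonzero real number λ_m and a real polynomial F in two variables of total degree at most 2m−1 such that, for n₃(t) = −sin t and all t ∈ ℝ: (L^m n₃)(t) = λ_m · sin^{2m−1}t·cos t / (r·γ(t)^{2m−1}) + F(sin t, cos t)/γ(t)^{2m−2}. -/
/-- A real polynomial in `sin` and `cos` of total degree at most `d`. -/
def IsTrigPoly (d : ℕ) (f : ℝ → ℝ) : Prop :=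
  ∃ F : MvPolynomial (Fin 2) ℝ, F.totalDegree ≤ d ∧
    ∀ t, f t = MvPolynomial.eval ![Real.sin t, Real.cos t] F

namespace IsTrigPoly

open MvPolynomial

variable {d e : ℕ} {f g : ℝ → ℝ}

theorem mono (hf : IsTrigPoly d f) (h : d ≤ e) : IsTrigPoly e f :=
  let ⟨F, hF, hFf⟩ := hf
  ⟨F, hF.trans h, hFf⟩

theorem add (hf : IsTrigPoly d f) (hg : IsTrigPoly d g) :
    IsTrigPoly d (fun t => f t + g t) := by
  obtain ⟨F, hF, hf⟩ := hf
  obtain ⟨G, hG, hg⟩ := hg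
  exact ⟨F + G, (totalDegree_add F G).trans (max_le hF hG), fun t => by simp [hf, hg]⟩

theorem mul (hf : IsTrigPoly d f) (hg : IsTrigPoly e g) :
    IsTrigPoly (d + e) (fun t => f t * g t) := by
  obtain ⟨F, hF, hf⟩ := hf
  obtain ⟨G, hG, hg⟩ := hg
  exact ⟨F * G, (totalDegree_mul F G).trans (add_le_add hF hG), fun t => by simp [hf, hg]⟩

theorem const (c : ℝ) : IsTrigPoly 0 (fun _ => c) :=
  ⟨C c, by simp, fun t => by simp⟩

theorem const_mul (hf : IsTrigPoly d f) (c : ℝ) : IsTrigPoly d (fun t => c * f t) := by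
  simpa using (const c).mul hf

theorem sin : IsTrigPoly 1 Real.sin :=
  ⟨X 0, by simp, fun t => by simp⟩

theorem cos : IsTrigPoly 1 Real.cos :=
  ⟨X 1, by simp, fun t => by simp⟩

theorem pow (hf : IsTrigPoly d f) (n : ℕ) : IsTrigPoly (n * d) (fun t => f t ^ n) := by
  obtain ⟨F, hF, hf⟩ := hf
  exact ⟨F ^ n, (totalDegree_pow F n).trans (Nat.mul_le_mul_left n hF), fun t => by simp [hf]⟩

theorem sum {ι : Type*} {s : Finset ι} {f : ι → ℝ → ℝ} (hf : ∀ i ∈ s, IsTrigPoly d (f i)) :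
    IsTrigPoly d (fun t => ∑ i ∈ s, f i t) := by
  classical
  induction s using Finset.induction_on with
  | empty => simpa using (const 0).mono d.zero_le
  | insert i s hi ih =>
    simpa [Finset.sum_insert hi] using
      (hf i (by simp)).add (ih fun j hj => hf j (Finset.mem_insert_of_mem hj))

theorem exists_hasDerivAt_sin_pow_mul_cos_pow (i j : ℕ) :
    ∃ g, IsTrigPoly (i + j) g ∧
      ∀ t, HasDerivAt (fun t => Real.sin t ^ i * Real.cos t ^ j) (g t) t := by
  refine ⟨fun t => (i * Real.sin t ^ (i - 1) * Real.cos t) * Real.cos t ^ j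
    + Real.sin t ^ i * (j * Real.cos t ^ (j - 1) * -Real.sin t), ?_, fun t =>
      ((Real.hasDerivAt_sin t).pow i).mul ((Real.hasDerivAt_cos t).pow j)⟩
  refine add ?_ ?_
  · rcases i with _ | i
    · simpa using (const 0).mono (Nat.zero_le _)
    · exact ((((sin.pow i).const_mul _).mul cos).mul (cos.pow j)).mono (by simp)
  · rcases j with _ | j
    · simpa using (const 0).mono (Nat.zero_le _)
    · have h := (sin.pow i).mul (((cos.pow j).const_mul ((j + 1 : ℕ) : ℝ)).mul (sin.const_mul (-1)))
      simpa using h.mono (e := i + (j + 1)) (by simp)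

theorem exists_hasDerivAt (hf : IsTrigPoly d f) :
    ∃ g, IsTrigPoly d g ∧ ∀ t, HasDerivAt f (g t) t := by
  obtain ⟨F, hF, hf⟩ := hf
  choose g hg hderiv using exists_hasDerivAt_sin_pow_mul_cos_pow
  refine ⟨fun t => ∑ m ∈ F.support, F.coeff m * g (m 0) (m 1) t, sum fun m hm => ?_, fun t => ?_⟩
  · refine ((hg (m 0) (m 1)).const_mul _).mono (le_trans ?_ hF)
    have h := le_totalDegree hm
    rwa [Finsupp.sum_fintype _ _ (fun _ => rfl), Fin.sum_univ_two] at h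
  · have h : f = fun t => ∑ m ∈ F.support,
        F.coeff m * (Real.sin t ^ m 0 * Real.cos t ^ m 1) := by
      funext t
      simp [hf, eval_eq', Fin.prod_univ_two]
    rw [h]
    exact HasDerivAt.fun_sum fun m _ => (hderiv (m 0) (m 1) t).const_mul _

end IsTrigPoly

theorem hasDerivAt_div_pow_add_mul_cos {a r : ℝ} {f : ℝ → ℝ} {f' t : ℝ} (k : ℕ)
    (hγ : a + r * Real.cos t ≠ 0) (hf : HasDerivAt f f' t) :
    HasDerivAt (fun s => f s / (a + r * Real.cos s) ^ k)
      (f' / (a + r * Real.cos t) ^ k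
        + k * r * (Real.sin t * f t) / (a + r * Real.cos t) ^ (k + 1)) t := by
  have h := hf.fun_div ((((Real.hasDerivAt_cos t).const_mul r).const_add a).fun_pow k)
    (pow_ne_zero k hγ)
  refine h.congr_deriv ?_
  rcases k with _ | k
  · simp
  · simp only [Nat.add_sub_cancel]
    field_simp
    ring

theorem Lop_div_pow {a r : ℝ} (hr : r ≠ 0) (hγ : ∀ t, a + r * Real.cos t ≠ 0)
    {f f' f'' : ℝ → ℝ} (hf : ∀ t, HasDerivAt f (f' t) t) (hf' : ∀ t, HasDerivAt f' (f'' t) t)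
    (k : ℕ) (t : ℝ) :
    Lop a r (fun s => f s / (a + r * Real.cos s) ^ k) t
      = -k ^ 2 * Real.sin t ^ 2 * f t / (a + r * Real.cos t) ^ (k + 2)
        + (-(1 / r ^ 2) * (f'' t * (a + r * Real.cos t)) + (1 - 2 * k) / r * (Real.sin t * f' t)
          + -(k / r) * (Real.cos t * f t)) / (a + r * Real.cos t) ^ (k + 1) := by
  have h1 : deriv (fun s => f s / (a + r * Real.cos s) ^ k) = fun s =>
      f' s / (a + r * Real.cos s) ^ k
        + k * r * (Real.sin s * f s) / (a + r * Real.cos s) ^ (k + 1) :=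
    funext fun s => (hasDerivAt_div_pow_add_mul_cos k (hγ s) (hf s)).deriv
  have h2 := (hasDerivAt_div_pow_add_mul_cos k (hγ t) (hf' t)).fun_add
    (hasDerivAt_div_pow_add_mul_cos (k + 1) (hγ t)
      (((Real.hasDerivAt_sin t).fun_mul (hf t)).const_mul (k * r)))
  have := hγ t
  rw [Lop, h1, h2.deriv]
  push_cast
  field_simp
  ring

theorem Lop_iterate_succ_neg_sin {a r : ℝ} (hr : r ≠ 0) (hγ : ∀ t, a + r * Real.cos t ≠ 0)
    (n : ℕ) :
    ∃ lam : ℝ, lam ≠ 0 ∧ ∃ F, IsTrigPoly (2 * n + 1) F ∧ ∀ t,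
      (Lop a r)^[n + 1] (fun s => -Real.sin s) t
        = lam * Real.sin t ^ (2 * n + 1) * Real.cos t / (r * (a + r * Real.cos t) ^ (2 * n + 1))
          + F t / (a + r * Real.cos t) ^ (2 * n) := by
  have hγpoly : IsTrigPoly 1 (fun t => a + r * Real.cos t) :=
    ((IsTrigPoly.const a).mono zero_le_one).add (IsTrigPoly.cos.const_mul r)
  induction n with
  | zero =>
    refine ⟨-1, by norm_num, fun t => -(1 / r ^ 2) * Real.sin t, IsTrigPoly.sin.const_mul _,
      fun t => ?_⟩
    have h1 : deriv (fun s => -Real.sin s) = fun s => -Real.cos s :=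
      funext fun s => (Real.hasDerivAt_sin s).fun_neg.deriv
    have := hγ t
    simp only [zero_add, Function.iterate_one, Lop, h1, (Real.hasDerivAt_cos t).fun_neg.deriv]
    field_simp
    ring
  | succ n ih =>
    obtain ⟨lam, hlam, F, hF, hL⟩ := ih
    have hB : IsTrigPoly (2 * n + 2) (fun t =>
        lam / r * (Real.sin t ^ (2 * n + 1) * Real.cos t) + F t * (a + r * Real.cos t)) :=
      ((((IsTrigPoly.sin.pow (2 * n + 1)).mul IsTrigPoly.cos).const_mul _).mono (by simp)).add
        (hF.mul hγpoly)
    obtain ⟨B', hB', hBd⟩ := hB.exists_hasDerivAt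
    obtain ⟨B'', hB'', hBd'⟩ := hB'.exists_hasDerivAt
    have key := Lop_div_pow hr hγ hBd hBd' (2 * n + 1)
    have hfun : (Lop a r)^[n + 1] (fun s => -Real.sin s) = fun t =>
        (lam / r * (Real.sin t ^ (2 * n + 1) * Real.cos t) + F t * (a + r * Real.cos t))
          / (a + r * Real.cos t) ^ (2 * n + 1) := by
      funext t
      have := hγ t
      rw [hL]
      generalize a + r * Real.cos t = γ at this ⊢
      field_simp
      ring
    refine ⟨-(2 * n + 1) ^ 2 * lam, mul_ne_zero (neg_ne_zero.2 (by positivity)) hlam, _,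
      ((((hB''.mul hγpoly).const_mul (-(1 / r ^ 2))).add
        (((IsTrigPoly.sin.mul hB').const_mul ((1 - 2 * (2 * n + 1 : ℕ)) / r)).mono (by omega))).add
        (((IsTrigPoly.cos.mul hB).const_mul (-((2 * n + 1 : ℕ) / r))).mono (by omega))).add
        ((((IsTrigPoly.sin.pow 2).mul hF).const_mul (-(2 * n + 1) ^ 2)).mono (by omega)),
      fun t => ?_⟩
    have := hγ t
    rw [Function.iterate_succ_apply', hfun, key]
    push_cast
    field_simp
    ring

/-- For the third Gauss map component `n₃(t) = −sin t` of the anchor ring and every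
`m ≥ 1` there exist a nonzero real `λ_m` and a real polynomial `F` in two variables of
total degree at most `2m−1` such that
`(L^m n₃)(t) = λ_m·sin^{2m−1}t·cos t/(r·γ(t)^{2m−1}) + F(sin t, cos t)/γ(t)^{2m−2}`. -/
theorem anchorRing_Lm_n3_structure (a r : ℝ) (hr : 0 < r) (hra : r < a)
    (m : ℕ) (hm : 1 ≤ m) :
    ∃ lam : ℝ, lam ≠ 0 ∧ ∃ F : MvPolynomial (Fin 2) ℝ, F.totalDegree ≤ 2 * m - 1 ∧
      ∀ t : ℝ,
        (Lop a r)^[m] (fun s => -Real.sin s) t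
          = lam * Real.sin t ^ (2 * m - 1) * Real.cos t
                / (r * (a + r * Real.cos t) ^ (2 * m - 1))
            + MvPolynomial.eval ![Real.sin t, Real.cos t] F
                / (a + r * Real.cos t) ^ (2 * m - 2) := by
  have hγ (t : ℝ) : a + r * Real.cos t ≠ 0 :=
    ne_of_gt (by nlinarith [Real.neg_one_le_cos t])
  obtain ⟨n, rfl⟩ := Nat.exists_eq_add_of_le' hm
  obtain ⟨lam, hlam, f, ⟨F, hF, hfF⟩, h⟩ := Lop_iterate_succ_neg_sin hr.ne' hγ n
  have h1 : 2 * (n + 1) - 1 = 2 * n + 1 := by omega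
  have h2 : 2 * (n + 1) - 2 = 2 * n := by omega
  rw [h1, h2]
  exact ⟨lam, hlam, F, hF, fun t => by rw [h, hfF]⟩
end

section
/- Let 0 < r < a and γ(t) = a + r·cos t. For every integer m ≥ 1 and every nonzero real number λ, there is no real polynomial R in two variables such that λ·sin^{2m−1}t·cos t + γ(t)·R(sin t, cos t) = 0 for all t ∈ ℝ. Equivalently, the function t ↦ λ·sin^{2m−1}t·cos t/(r·γ(t)) + R(sin t, cos t) is not identically zero on ℝ for any real polynomial R in two variables. -/
open Filter Topology in
/-- An entire function that vanishes on the real line vanishes identically. -/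
theorem Complex.eq_zero_of_differentiable_of_ofReal_eq_zero {f : ℂ → ℂ}
    (hf : Differentiable ℂ f) (h : ∀ t : ℝ, f t = 0) (z : ℂ) : f z = 0 := by
  have hA : AnalyticOnNhd ℂ f Set.univ := fun w _ => hf.analyticAt w
  have ht : Tendsto ((↑) : ℝ → ℂ) (𝓝[≠] 0) (𝓝[≠] 0) := by
    refine tendsto_nhdsWithin_iff.2 ⟨?_, ?_⟩
    · exact (Complex.continuous_ofReal.tendsto' 0 0 Complex.ofReal_zero).mono_left
        nhdsWithin_le_nhds
    · filter_upwards [self_mem_nhdsWithin] with t ht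
      simpa using ht
  have hfr : ∃ᶠ w in 𝓝[≠] (0 : ℂ), f w = 0 :=
    ht.frequently (Frequently.of_forall h)
  exact hA.eqOn_zero_of_preconnected_of_frequently_eq_zero isPreconnected_univ
    (Set.mem_univ 0) hfr (Set.mem_univ z)

/-- A polynomial in `sin` and `cos` over `ℝ` extends to an entire function. -/
theorem MvPolynomial.differentiable_aeval_sin_cos (R : MvPolynomial (Fin 2) ℝ) :
    Differentiable ℂ fun z => MvPolynomial.aeval ![Complex.sin z, Complex.cos z] R := by
  induction R using MvPolynomial.induction_on with
  | C c => simp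
  | add p q hp hq => simpa using hp.fun_add hq
  | mul_X p i hp =>
    fin_cases i
    · simpa using hp.fun_mul Complex.differentiable_sin
    · simpa using hp.fun_mul Complex.differentiable_cos

theorem MvPolynomial.aeval_sin_cos_ofReal (R : MvPolynomial (Fin 2) ℝ) (t : ℝ) :
    MvPolynomial.aeval ![Complex.sin t, Complex.cos t] R =
      ((MvPolynomial.eval ![Real.sin t, Real.cos t] R : ℝ) : ℂ) := by
  induction R using MvPolynomial.induction_on with
  | C c => simp
  | add p q hp hq => simp [hp, hq]
  | mul_X p i hp => fin_cases i <;> simp [hp]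

/-- At a complex zero of `a + r * cos z`, neither `sin z` nor `cos z` vanishes, so
`a + r * cos t` does not divide `lam * sin t ^ n * cos t` among trigonometric polynomials. -/
theorem not_forall_sin_pow_mul_cos_add_eq_zero {a r : ℝ} (hr : 0 < r) (hra : r < a) (n : ℕ)
    {lam : ℝ} (hlam : lam ≠ 0) (R : MvPolynomial (Fin 2) ℝ) :
    ¬ ∀ t : ℝ, lam * Real.sin t ^ n * Real.cos t
      + (a + r * Real.cos t) * MvPolynomial.eval ![Real.sin t, Real.cos t] R = 0 := by
  intro h
  obtain ⟨z, hz⟩ := Complex.cos_surjective ((-(a / r) : ℝ) : ℂ)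
  have hd : Differentiable ℂ fun w : ℂ => (lam : ℂ) * Complex.sin w ^ n * Complex.cos w
      + (a + r * Complex.cos w) * MvPolynomial.aeval ![Complex.sin w, Complex.cos w] R := by
    have := R.differentiable_aeval_sin_cos
    fun_prop
  have hzero := Complex.eq_zero_of_differentiable_of_ofReal_eq_zero hd (fun t => by
    rw [R.aeval_sin_cos_ofReal]
    exact_mod_cast h t) z
  have hγ : (a : ℂ) + r * Complex.cos z = 0 := by
    rw [hz]
    norm_cast
    field_simp
    ring
  have har : 1 < a / r := (one_lt_div hr).2 hra
  have hcos : Complex.cos z ≠ 0 := by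
    rw [hz]
    norm_cast
    linarith
  have hsin : Complex.sin z ≠ 0 := by
    intro hs
    have hsq := Complex.sin_sq_add_cos_sq z
    rw [hs, hz] at hsq
    norm_cast at hsq
    nlinarith
  simp [hγ, hlam, hsin, hcos] at hzero

/-- With `γ(t) = a + r cos t` (where `0 < r < a`), for every `m ≥ 1` and every nonzero
real `λ` there is no real polynomial `R` in two variables with
`λ·sin^{2m−1}t·cos t + γ(t)·R(sin t, cos t) = 0` for all `t`; equivalently, the function
`t ↦ λ·sin^{2m−1}t·cos t/(r·γ(t)) + R(sin t, cos t)` is never identically zero. -/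
theorem anchorRing_no_poly_relation (a r : ℝ) (hr : 0 < r) (hra : r < a)
    (m : ℕ) (hm : 1 ≤ m) (lam : ℝ) (hlam : lam ≠ 0) :
    (¬ ∃ R : MvPolynomial (Fin 2) ℝ, ∀ t : ℝ,
        lam * Real.sin t ^ (2 * m - 1) * Real.cos t
          + (a + r * Real.cos t) * MvPolynomial.eval ![Real.sin t, Real.cos t] R = 0) ∧
    (∀ R : MvPolynomial (Fin 2) ℝ, ¬ ∀ t : ℝ,
        lam * Real.sin t ^ (2 * m - 1) * Real.cos t / (r * (a + r * Real.cos t))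
          + MvPolynomial.eval ![Real.sin t, Real.cos t] R = 0) := by
  refine ⟨fun ⟨R, hR⟩ => not_forall_sin_pow_mul_cos_add_eq_zero hr hra _ hlam R hR,
    fun R hR => not_forall_sin_pow_mul_cos_add_eq_zero hr hra (2 * m - 1) hlam
      (MvPolynomial.C r * R) fun t => ?_⟩
  have hγ : 0 < a + r * Real.cos t := by nlinarith [Real.neg_one_le_cos t]
  have h := hR t
  rw [div_add' _ _ _ (by positivity), div_eq_zero_iff, or_iff_left (by positivity)] at h
  rw [map_mul, MvPolynomial.eval_C]
  linear_combination h
end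

section
/- Let 0 < r < a, γ(t) = a + r·cos t, and let L be the operator (L f)(t) = −(1/r²)·f''(t) + (sin t/(r·γ(t)))·f'(t) acting on smooth functions f : ℝ → ℝ, the Laplace–Beltrami operator of the anchor ring restricted to functions of t. Then the function n₃(t) = −sin t (the third component of the Gauss map of the anchor ring) is not of finite type with respect to L: there do not exist an integer k ≥ 1, a constant b ∈ ℝ, smooth nonconstant functions f₁, …, f_k : ℝ → ℝ, and pairwise distinct real numbers λ₁, …, λ_k with L f_i = λ_i·f_i for each i, such that n₃ = b + f₁ + ⋯ + f_k. -/
open Polynomial in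
/-- The operator induced by `Lop a r` on polynomials `q`, where `q` stands for the function
`sin t * q (1 / (a + r cos t))`. -/
noncomputable def polyLop (a r : ℝ) (q : ℝ[X]) : ℝ[X] :=
  C (2 / r ^ 2) * q - C (a / r ^ 2) * (X * q)
    - C (3 / r ^ 2) * (X * derivative q) + C (3 * a / r ^ 2) * (X * (X * derivative q))
    + C (1 / r ^ 2) * (X * derivative (X * derivative q))
    - C (2 * a / r ^ 2) * (X * (X * derivative (X * derivative q)))
    - C (1 - a ^ 2 / r ^ 2) * (X * (X * (X * derivative (X * derivative q))))

open Polynomial in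
theorem coeff_X_mul_derivative (q : ℝ[X]) (n : ℕ) :
    (X * derivative q).coeff n = n * q.coeff n := by
  cases n with
  | zero => simp
  | succ n => rw [coeff_X_mul, coeff_derivative]; push_cast; ring

open Polynomial in
theorem one_le_natDegree_polyLop_sub {a r : ℝ} (hr : 0 < r) (hra : r < a) (l : ℝ) {q : ℝ[X]}
    (hq : 1 ≤ q.natDegree) : 1 ≤ (polyLop a r q - C l * q).natDegree := by
  set n := q.natDegree with hn
  have hlead : q.coeff n ≠ 0 := by
    rw [hn, coeff_natDegree]
    exact leadingCoeff_ne_zero.mpr (ne_zero_of_natDegree_gt hq)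
  have h1 : q.coeff (n + 1) = 0 := coeff_eq_zero_of_natDegree_lt (by omega)
  have h2 : q.coeff (n + 2) = 0 := coeff_eq_zero_of_natDegree_lt (by omega)
  have hc : (polyLop a r q - C l * q).coeff (n + 2)
      = -((1 - a ^ 2 / r ^ 2) * (n * (n * q.coeff n))) := by
    have hX (p : ℝ[X]) : (X * p).coeff (n + 2) = p.coeff (n + 1) := coeff_X_mul p (n + 1)
    have hT := coeff_X_mul_derivative q
    have hTT := coeff_X_mul_derivative (X * derivative q)
    rw [polyLop]
    generalize X * derivative (X * derivative q) = TT at *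
    generalize X * derivative q = T at *
    simp only [coeff_sub, coeff_add, coeff_C_mul, hX, coeff_X_mul, hTT, hT, h1, h2]
    ring
  have har : 1 - a ^ 2 / r ^ 2 ≠ 0 := by
    have : 1 < a ^ 2 / r ^ 2 := by
      rw [one_lt_div (by positivity)]
      gcongr
    linarith
  have hn0 : (n : ℝ) ≠ 0 := by positivity
  have := le_natDegree_of_ne_zero (p := polyLop a r q - C l * q) (n := n + 2) (by
    rw [hc]
    exact neg_ne_zero.mpr (mul_ne_zero har (mul_ne_zero hn0 (mul_ne_zero hn0 hlead))))
  omega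

theorem hasDerivAt_inv_radius {a r : ℝ} (hr : 0 < r) (hra : r < a) (t : ℝ) :
    HasDerivAt (fun t => (a + r * Real.cos t)⁻¹)
      (r * Real.sin t * (a + r * Real.cos t)⁻¹ ^ 2) t := by
  have h := (((Real.hasDerivAt_cos t).const_mul r).const_add a).inv
    (anchorRing_radius_pos hr hra t).ne'
  refine h.congr_deriv ?_
  rw [inv_pow, ← div_eq_mul_inv]
  ring

open Polynomial in
theorem hasDerivAt_eval_inv_radius {a r : ℝ} (hr : 0 < r) (hra : r < a) (q : ℝ[X]) (t : ℝ) :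
    HasDerivAt (fun t => q.eval (a + r * Real.cos t)⁻¹)
      ((derivative q).eval (a + r * Real.cos t)⁻¹
        * (r * Real.sin t * (a + r * Real.cos t)⁻¹ ^ 2)) t :=
  (q.hasDerivAt _).comp t (hasDerivAt_inv_radius hr hra t)

open Polynomial in
theorem Lop_sin_mul_eval {a r : ℝ} (hr : 0 < r) (hra : r < a) (q : ℝ[X]) (t : ℝ) :
    Lop a r (fun t => Real.sin t * q.eval (a + r * Real.cos t)⁻¹) t
      = Real.sin t * (polyLop a r q).eval (a + r * Real.cos t)⁻¹ := by
  have hd : deriv (fun t => Real.sin t * q.eval (a + r * Real.cos t)⁻¹)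
      = fun t => Real.cos t * q.eval (a + r * Real.cos t)⁻¹
        + Real.sin t * ((derivative q).eval (a + r * Real.cos t)⁻¹
          * (r * Real.sin t * (a + r * Real.cos t)⁻¹ ^ 2)) :=
    funext fun t => ((Real.hasDerivAt_sin t).mul (hasDerivAt_eval_inv_radius hr hra q t)).deriv
  have hdd := (((Real.hasDerivAt_cos t).mul (hasDerivAt_eval_inv_radius hr hra q t)).add
    ((Real.hasDerivAt_sin t).mul ((hasDerivAt_eval_inv_radius hr hra (derivative q) t).mul
      (((Real.hasDerivAt_sin t).const_mul r).mul
        ((hasDerivAt_inv_radius hr hra t).pow 2))))).deriv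
  change deriv (fun t => Real.cos t * q.eval (a + r * Real.cos t)⁻¹
    + Real.sin t * ((derivative q).eval (a + r * Real.cos t)⁻¹
      * (r * Real.sin t * (a + r * Real.cos t)⁻¹ ^ 2))) t = _ at hdd
  rw [Lop, hd, hdd]
  have hg := (anchorRing_radius_pos hr hra t).ne'
  have hcos : Real.cos t = ((a + r * Real.cos t) - a) / r := by field_simp; ring
  have hsin : Real.sin t ^ 2 = 1 - (((a + r * Real.cos t) - a) / r) ^ 2 := by
    rw [← hcos, Real.sin_sq]
  simp only [polyLop, eval_sub, eval_add, eval_mul, eval_C, eval_X, derivative_mul,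
    derivative_X, one_mul, Pi.mul_apply, Pi.pow_apply, Nat.cast_ofNat, Nat.add_one_sub_one,
    pow_one]
  clear hd hdd
  generalize a + r * Real.cos t = g at *
  generalize eval g⁻¹ q = q0
  generalize eval g⁻¹ (derivative q) = q1
  generalize eval g⁻¹ (derivative (derivative q)) = q2
  generalize Real.sin t = s at *
  rw [hcos]
  have hr0 := hr.ne'
  linear_combination (norm := (field_simp; ring))
    s * (-q2 * g⁻¹ ^ 4 - q1 * g⁻¹ ^ 3) * hsin

theorem Lop_sum {ι : Type*} (a r : ℝ) (s : Finset ι) (c : ι → ℝ) {f : ι → ℝ → ℝ}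
    (hf : ∀ i, ContDiff ℝ (⊤ : ℕ∞) (f i)) (t : ℝ) :
    Lop a r (fun t => ∑ i ∈ s, c i * f i t) t = ∑ i ∈ s, c i * Lop a r (f i) t := by
  have h1 (i : ι) : Differentiable ℝ (f i) := (hf i).differentiable (by simp)
  have h2 (i : ι) : Differentiable ℝ (deriv (f i)) :=
    ((contDiff_infty_iff_deriv.mp (hf i)).2).differentiable (by simp)
  have hd : deriv (fun t => ∑ i ∈ s, c i * f i t) = fun t => ∑ i ∈ s, c i * deriv (f i) t := by
    funext t
    rw [deriv_fun_sum fun i _ => ((h1 i) t).const_mul _]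
    exact Finset.sum_congr rfl fun i _ => deriv_const_mul _ ((h1 i) t)
  have hdd : deriv (fun t => ∑ i ∈ s, c i * deriv (f i) t) t
      = ∑ i ∈ s, c i * deriv (deriv (f i)) t := by
    rw [deriv_fun_sum fun i _ => ((h2 i) t).const_mul _]
    exact Finset.sum_congr rfl fun i _ => deriv_const_mul _ ((h2 i) t)
  rw [Lop, hd, hdd, Finset.mul_sum, Finset.mul_sum, ← Finset.sum_add_distrib]
  exact Finset.sum_congr rfl fun i _ => by rw [Lop]; ring

open Polynomial in
theorem eq_zero_of_sin_mul_eval_eq_zero {a r : ℝ} (hr : 0 < r) {q : ℝ[X]}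
    (h : ∀ t, Real.sin t * q.eval (a + r * Real.cos t)⁻¹ = 0) : q = 0 := by
  refine q.eq_zero_of_infinite_isRoot (Set.Infinite.mono (s := (fun t =>
    (a + r * Real.cos t)⁻¹) '' Set.Ioo 0 Real.pi) ?_ ((Set.Ioo_infinite Real.pi_pos).image ?_))
  · rintro _ ⟨t, ht, rfl⟩
    exact (mul_eq_zero.mp (h t)).resolve_left (Real.sin_pos_of_mem_Ioo ht).ne'
  · intro s hs t ht hst
    have : Real.cos s = Real.cos t :=
      mul_left_cancel₀ hr.ne' (add_left_cancel (inv_injective hst))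
    exact Real.injOn_cos (Set.Ioo_subset_Icc_self hs) (Set.Ioo_subset_Icc_self ht) this

open Polynomial in
theorem sin_mul_eval_ne_sum_eigenfunctions {ι : Type*} {a r : ℝ} (hr : 0 < r) (hra : r < a)
    {f : ι → ℝ → ℝ} {lam : ι → ℝ} (hf : ∀ i, ContDiff ℝ (⊤ : ℕ∞) (f i))
    (hlam : ∀ i t, Lop a r (f i) t = lam i * f i t) (s : Finset ι) (c : ι → ℝ) {q : ℝ[X]}
    (hq : 1 ≤ q.natDegree) :
    ¬ ∀ t, Real.sin t * q.eval (a + r * Real.cos t)⁻¹ = ∑ i ∈ s, c i * f i t := by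
  classical
  induction s using Finset.induction_on generalizing c q with
  | empty =>
    intro h
    rw [eq_zero_of_sin_mul_eval_eq_zero hr (q := q) (by simpa using h)] at hq
    simp at hq
  | insert j s hj ih =>
    intro h
    refine ih (fun i => (lam i - lam j) * c i)
      (one_le_natDegree_polyLop_sub hr hra (lam j) hq) fun t => ?_
    have hL : Real.sin t * (polyLop a r q).eval (a + r * Real.cos t)⁻¹
        = ∑ i ∈ insert j s, c i * (lam i * f i t) := by
      rw [← Lop_sin_mul_eval hr hra, funext h, Lop_sum a r _ c hf]
      simp only [hlam]
    rw [eval_sub, eval_mul, eval_C, mul_sub, hL, mul_left_comm, h t, Finset.mul_sum,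
      ← Finset.sum_sub_distrib, Finset.sum_insert hj]
    rw [show c j * (lam j * f j t) - lam j * (c j * f j t) = 0 by ring, zero_add]
    exact Finset.sum_congr rfl fun i _ => by ring

/-- The third Gauss map component `n₃(t) = −sin t` of the anchor ring is not of finite
type with respect to `L`: it cannot be written as a constant plus a finite sum of smooth
nonconstant eigenfunctions of `L` with pairwise distinct eigenvalues. -/
theorem anchorRing_n3_not_finite_type (a r : ℝ) (hr : 0 < r) (hra : r < a) :
    ¬ ∃ (k : ℕ) (_ : 1 ≤ k) (b : ℝ) (f : Fin k → ℝ → ℝ) (lam : Fin k → ℝ),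
        (∀ i, ContDiff ℝ (⊤ : ℕ∞) (f i)) ∧
        (∀ i, ∃ s t : ℝ, f i s ≠ f i t) ∧
        Function.Injective lam ∧
        (∀ i t, Lop a r (f i) t = lam i * f i t) ∧
        (∀ t : ℝ, -Real.sin t = b + ∑ i, f i t) := by
  rintro ⟨k, -, b, f, lam, hf, -, -, hlam, h⟩
  have hL (t : ℝ) : Real.sin t * (polyLop a r (-1)).eval (a + r * Real.cos t)⁻¹
      = ∑ i, lam i * f i t := by
    have hfun : (fun t => Real.sin t * (-1 : Polynomial ℝ).eval (a + r * Real.cos t)⁻¹)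
        = fun t => b + ∑ i, 1 * f i t := by
      funext t
      simpa using h t
    have hconst : Lop a r (fun t => b + ∑ i, 1 * f i t) t
        = Lop a r (fun t => ∑ i, 1 * f i t) t := by
      simp only [Lop, deriv_const_add']
    rw [← Lop_sin_mul_eval hr hra, hfun, hconst, Lop_sum a r _ (fun _ => 1) hf]
    simp only [hlam, one_mul]
  refine sin_mul_eval_ne_sum_eigenfunctions hr hra hf hlam Finset.univ lam ?_ hL
  have ha : a ≠ 0 := (hr.trans hra).ne'
  refine Polynomial.le_natDegree_of_ne_zero (n := 1) ?_
  simp [polyLop, ha, hr.ne']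
end
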